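/- arXiv:1101.5382 — 2 statements merged into one kernel-verified Lean document; each statement's English description precedes it below -/
import Mathlib

section
/- If v ∈ 𝔰 with v ≠ 0 and τ ∈ 𝔯₋ˣ, then Φ([v,τ]) ≠ 0 and Φ([v,τ]) ∈ 𝔰₋. -/
open scoped InnerProductSpace BigOperators

structure RootSystemData (V : Type*) [NormedAddCommGroup V] [InnerProductSpace ℝ V] where
  Δ : Set V
  finite : Δ.Finite
  span_top : Submodule.span ℝ Δ = ⊤
  zero_not_mem : (0 : V) ∉ Δ
  neg_mem : ∀ α ∈ Δ, -α ∈ Δ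
  reduced : ∀ α ∈ Δ, ∀ t : ℝ, t • α ∈ Δ → t = 1 ∨ t = -1
  crystal : ∀ α ∈ Δ, ∀ β ∈ Δ, ∃ n : ℤ, 2 * ⟪α, β⟫_ℝ = (n : ℝ) * ⟪β, β⟫_ℝ
  reflect_mem : ∀ α ∈ Δ, ∀ β ∈ Δ, α - (2 * ⟪α, β⟫_ℝ / ⟪β, β⟫_ℝ) • β ∈ Δ
  Pos : Set V
  pos_subset : Pos ⊆ Δ
  mem_or_neg : ∀ α ∈ Δ, α ∈ Pos ∨ -α ∈ Pos
  not_neg_mem : ∀ α ∈ Pos, -α ∉ Pos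
  pos_add : ∀ α ∈ Pos, ∀ β ∈ Pos, α + β ∈ Δ → α + β ∈ Pos

namespace RootSystemData

variable {V : Type*} [NormedAddCommGroup V] [InnerProductSpace ℝ V] (R : RootSystemData V)

/-- The set of simple roots: indecomposable positive roots. -/
def Simple : Set V := {α ∈ R.Pos | ¬ ∃ β ∈ R.Pos, ∃ γ ∈ R.Pos, α = β + γ}

/-- The support `Π(φ)` of a positive root: the simple roots needed to express `φ`. -/
def support (φ : V) : Set V := {α ∈ R.Simple | φ ∉ Submodule.span ℝ (R.Simple \ {α})}

/-- The root subsystem `Δ(φ)`: all roots lying in the span of the support of `φ`. -/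
def sub (φ : V) : Set V := {ψ ∈ R.Δ | ψ ∈ Submodule.span ℝ (R.support φ)}

/-- The positive roots `Δ(φ)₊` of the subsystem `Δ(φ)`. -/
def posSub (φ : V) : Set V := R.sub φ ∩ R.Pos

/-- `x` is a nonnegative integer combination of positive roots. -/
def NonnegComb (x : V) : Prop :=
  ∃ c : V →₀ ℕ, ↑c.support ⊆ R.Pos ∧ x = c.sum fun α n => (n : ℝ) • α

/-- `β` is the highest root of the subset `S`. -/
def IsHighest (S : Set V) (β : V) : Prop :=
  β ∈ S ∧ β ∈ R.Pos ∧ ∀ ψ ∈ S, R.NonnegComb (β - ψ)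

/-- `β` is locally high: it is the highest root of `Δ(β)`. -/
def LocallyHigh (β : V) : Prop := β ∈ R.Pos ∧ R.IsHighest (R.sub β) β

/-- `E(β) = {φ ∈ Δ(β) : (φ,β) > 0}`. -/
def E (β : V) : Set V := {φ ∈ R.sub β | 0 < ⟪φ, β⟫_ℝ}

/-- `Δ(β)° = {φ ∈ Δ(β) : (φ,β) = 0}`. -/
def orth (β : V) : Set V := {φ ∈ R.sub β | ⟪φ, β⟫_ℝ = 0}

/-- Strong orthogonality of two roots. -/
def StronglyOrth (φ ψ : V) : Prop := φ + ψ ∉ R.Δ ∧ φ - ψ ∉ R.Δ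

/-- Half the sum of the positive roots of `Δ(β)`. -/
noncomputable def rho (β : V) : V := (2⁻¹ : ℝ) • ∑ᶠ φ ∈ R.posSub β, φ

/-- The dual Coxeter number of `Δ(β)`, `⟨ρ_β, β^∨⟩ + 1`. -/
noncomputable def dualCoxeter (β : V) : ℝ := 2 * ⟪R.rho β, β⟫_ℝ / ⟪β, β⟫_ℝ + 1

end RootSystemData

/-- A finite set of vectors is irreducible if it is nonempty and admits no splitting into
two nonempty mutually orthogonal pieces. -/
def IsIrred {V : Type*} [NormedAddCommGroup V] [InnerProductSpace ℝ V] (S : Set V) : Prop :=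
  S.Nonempty ∧ ¬ ∃ A B : Set V, A ∪ B = S ∧ A ∩ B = ∅ ∧ A.Nonempty ∧ B.Nonempty ∧
    ∀ a ∈ A, ∀ b ∈ B, ⟪a, b⟫_ℝ = 0

/-- `C` is an irreducible component of `S`. -/
def IsComponent {V : Type*} [NormedAddCommGroup V] [InnerProductSpace ℝ V]
    (S C : Set V) : Prop :=
  C ⊆ S ∧ IsIrred C ∧ ∀ a ∈ C, ∀ b ∈ S \ C, ⟪a, b⟫_ℝ = 0

/-- The reflection `s_β` in the (co)vector `β`. -/
noncomputable def reflectRoot {V : Type*} [NormedAddCommGroup V] [InnerProductSpace ℝ V]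
    (β v : V) : V := v - (2 * ⟪v, β⟫_ℝ / ⟪β, β⟫_ℝ) • β

namespace RootSystemData

variable {V : Type*} [NormedAddCommGroup V] [InnerProductSpace ℝ V] (R : RootSystemData V)

/-- A chain cascade: a nonempty list whose head is the highest root of an irreducible
component of `Δ`, and each subsequent entry is the highest root of an irreducible component
of `Δ(previous)°`. -/
def IsChainCascade (l : List V) : Prop :=
  l ≠ [] ∧
  (∀ b ∈ l.head?, ∃ C, IsComponent R.Δ C ∧ R.IsHighest C b) ∧
  l.Chain' fun γ δ => ∃ C, IsComponent (R.orth γ) C ∧ R.IsHighest C δ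

/-- The cascade `ℬ` of roots: all positive roots belonging to some chain cascade. -/
def cascade : Set V := {β | ∃ l, R.IsChainCascade l ∧ β ∈ l}

/-- `l` is the chain cascade `C(φ)` associated to the positive root `φ`. -/
def IsCascadeChainOf (φ : V) (l : List V) : Prop :=
  R.IsChainCascade l ∧ (∀ β ∈ l, φ ∈ R.sub β) ∧
  (∀ β ∈ l.dropLast, ⟪φ, β⟫_ℝ = 0) ∧ ∀ β ∈ l.getLast?, 0 < ⟪φ, β⟫_ℝ

end RootSystemData

section LieSetup

variable (V : Type*) [NormedAddCommGroup V] [InnerProductSpace ℝ V]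
  (L : Type*) [LieRing L] [LieAlgebra ℂ L] [Module.Finite ℂ L]

/-- A triangular decomposition of a finite-dimensional complex semisimple Lie algebra `L`,
with Cartan subalgebra `H`, root system `Δ` (realized in the real inner product space `V`,
the inner product being the one induced by the Killing form), chosen root vectors `e φ`,
and the projection `Φ : L → 𝔫₋` with kernel `𝔟 = 𝔥 ⊕ 𝔫`. -/
structure CascadeLieData extends RootSystemData V where
  /-- the root vectors `e_φ` -/
  e : V → L
  /-- the Cartan subalgebra `𝔥` -/
  H : LieSubalgebra ℂ L
  /-- the realization of `V` inside `𝔥*`: each `φ ∈ V` gives a functional on `𝔥` -/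
  wt : V →ₗ[ℝ] (H →ₗ[ℂ] ℂ)
  wt_inj : Function.Injective wt
  e_ne : ∀ φ ∈ Δ, e φ ≠ 0
  indep : LinearIndependent ℂ fun φ : Δ => e (φ : V)
  root_vec : ∀ x : H, ∀ φ ∈ Δ, ⁅(x : L), e φ⁆ = wt φ x • e φ
  bracket_add : ∀ φ ∈ Δ, ∀ ψ ∈ Δ, φ + ψ ∈ Δ →
    ∃ c : ℂ, c ≠ 0 ∧ ⁅e φ, e ψ⁆ = c • e (φ + ψ)
  bracket_zero : ∀ φ ∈ Δ, ∀ ψ ∈ Δ, φ + ψ ∉ Δ → φ + ψ ≠ 0 → ⁅e φ, e ψ⁆ = 0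
  bracket_opp : ∀ φ ∈ Δ, ⁅e φ, e (-φ)⁆ ∈ H
  span_eq_top : H.toSubmodule ⊔ Submodule.span ℂ (e '' Δ) = ⊤
  killing_pair : ∀ φ ∈ Δ, killingForm ℂ L (e φ) (e (-φ)) ≠ 0
  killing_orth : ∀ φ ∈ Δ, ∀ ψ ∈ Δ, φ + ψ ≠ 0 → killingForm ℂ L (e φ) (e ψ) = 0
  /-- the projection `Φ : 𝔤 → 𝔫₋` with kernel `𝔟` -/
  Φ : L →ₗ[ℂ] L
  Φ_neg : ∀ z ∈ Submodule.span ℂ (e '' (Neg.neg '' Pos)), Φ z = z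
  Φ_b : ∀ z ∈ H.toSubmodule ⊔ Submodule.span ℂ (e '' Pos), Φ z = 0

end LieSetup

namespace CascadeLieData

variable {V : Type*} [NormedAddCommGroup V] [InnerProductSpace ℝ V]
  {L : Type*} [LieRing L] [LieAlgebra ℂ L] [Module.Finite ℂ L]
  (C : CascadeLieData V L)

/-- The nilradical `𝔫 = ⊕_{φ∈Δ₊} 𝔤_φ`. -/
def nSub : Submodule ℂ L := Submodule.span ℂ (C.e '' C.Pos)

/-- The opposite nilradical `𝔫₋`. -/
def nMinus : Submodule ℂ L := Submodule.span ℂ (C.e '' (Neg.neg '' C.Pos))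

/-- The Borel subalgebra `𝔟 = 𝔥 ⊕ 𝔫` (as a subspace). -/
def bSub : Submodule ℂ L := C.H.toSubmodule ⊔ C.nSub

/-- `𝔯 = span{e_β : β ∈ ℬ}`. -/
def rSub : Submodule ℂ L := Submodule.span ℂ (C.e '' C.toRootSystemData.cascade)

/-- `𝔯₋ = span{e_{−β} : β ∈ ℬ}`. -/
def rMinus : Submodule ℂ L :=
  Submodule.span ℂ (C.e '' (Neg.neg '' C.toRootSystemData.cascade))

/-- `𝔯₋ˣ`: the elements of `𝔯₋` all of whose coefficients are nonzero. -/
def rMinusX : Set L :=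
  {z | ∃ a : V → ℂ, (∀ β ∈ C.toRootSystemData.cascade, a β ≠ 0) ∧
    z = ∑ᶠ β ∈ C.toRootSystemData.cascade, a β • C.e (-β)}

/-- `𝔰 = span{e_φ : φ ∈ Δ₊ \ ℬ}`. -/
def sSub : Submodule ℂ L :=
  Submodule.span ℂ (C.e '' (C.Pos \ C.toRootSystemData.cascade))

/-- `𝔰₋ = span{e_{−φ} : φ ∈ Δ₊ \ ℬ}`. -/
def sMinus : Submodule ℂ L :=
  Submodule.span ℂ (C.e '' (Neg.neg '' (C.Pos \ C.toRootSystemData.cascade)))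

/-- `𝔰(β) = span{e_φ : φ ∈ E(β), φ ≠ β}`. -/
def sBeta (β : V) : Submodule ℂ L :=
  Submodule.span ℂ (C.e '' (C.toRootSystemData.E β \ {β}))

/-- `𝔰(−β) = span{e_{−φ} : φ ∈ E(β), φ ≠ β}`. -/
def sBetaMinus (β : V) : Submodule ℂ L :=
  Submodule.span ℂ (C.e '' (Neg.neg '' (C.toRootSystemData.E β \ {β})))

/-- `𝔢(β) = span{e_φ : φ ∈ E(β)}`. -/
def eSub (β : V) : Submodule ℂ L := Submodule.span ℂ (C.e '' C.toRootSystemData.E β)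

/-- `𝔤(β)`: the Lie subalgebra generated by the root spaces `𝔤_{±α}`, `α ∈ Π(β)`. -/
def gSub (β : V) : LieSubalgebra ℂ L :=
  LieSubalgebra.lieSpan ℂ L
    (C.e '' C.toRootSystemData.support β ∪ C.e '' (Neg.neg '' C.toRootSystemData.support β))

end CascadeLieData

namespace RootSystemData

variable {V : Type*} [NormedAddCommGroup V] [InnerProductSpace ℝ V] (R : RootSystemData V)

theorem ne_zero_of_mem {x : V} (hx : x ∈ R.Δ) : x ≠ 0 :=
  fun h => R.zero_not_mem (h ▸ hx)

theorem inner_self_pos_of_mem {x : V} (hx : x ∈ R.Δ) : 0 < ⟪x, x⟫_ℝ :=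
  real_inner_self_pos.2 (R.ne_zero_of_mem hx)

theorem pos_of_neg_notMem {x : V} (hx : x ∈ R.Δ) (h : -x ∉ R.Pos) : x ∈ R.Pos :=
  (R.mem_or_neg x hx).resolve_right h

theorem sub_mem_of_inner_pos {x y : V} (hx : x ∈ R.Δ) (hy : y ∈ R.Δ) (h : 0 < ⟪x, y⟫_ℝ)
    (hne : x ≠ y) : x - y ∈ R.Δ := by
  obtain ⟨n, hn⟩ := R.crystal x hx y hy
  obtain ⟨m, hm⟩ := R.crystal y hy x hx
  have hx0 := R.inner_self_pos_of_mem hx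
  have hy0 := R.inner_self_pos_of_mem hy
  rw [real_inner_comm] at hm
  have hn0 : 0 < n := by
    by_contra! hc
    have : (n : ℝ) ≤ 0 := by exact_mod_cast hc
    nlinarith
  have hm0 : 0 < m := by
    by_contra! hc
    have : (m : ℝ) ≤ 0 := by exact_mod_cast hc
    nlinarith
  have h1 := R.reflect_mem x hx y hy
  have h2 := R.reflect_mem y hy x hx
  rw [hn, mul_div_cancel_right₀ _ hy0.ne'] at h1
  rw [real_inner_comm, hm, mul_div_cancel_right₀ _ hx0.ne'] at h2
  by_cases hn1 : n = 1
  · simpa [hn1] using h1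
  by_cases hm1 : m = 1
  · have := R.neg_mem _ h2
    simpa [hm1] using this
  exfalso
  have hn2 : (2 : ℝ) ≤ n := by exact_mod_cast (by omega : 2 ≤ n)
  have hm2 : (2 : ℝ) ≤ m := by exact_mod_cast (by omega : 2 ≤ m)
  have hxy : ⟪x - y, x - y⟫_ℝ ≤ 0 := by
    rw [real_inner_sub_sub_self]
    nlinarith
  exact hne (sub_eq_zero.1 (real_inner_self_nonpos.1 hxy))

theorem add_mem_of_inner_neg {x y : V} (hx : x ∈ R.Δ) (hy : y ∈ R.Δ) (h : ⟪x, y⟫_ℝ < 0)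
    (hne : x ≠ -y) : x + y ∈ R.Δ := by
  have := R.sub_mem_of_inner_pos hx (R.neg_mem y hy) (by simpa using h) hne
  simpa using this

theorem add_mem_of_orthogonal {x y : V} (hy : y ∈ R.Δ) (h : ⟪x, y⟫_ℝ = 0)
    (hxy : x - y ∈ R.Δ) : x + y ∈ R.Δ := by
  have hy0 := R.inner_self_pos_of_mem hy
  have := R.reflect_mem _ hxy y hy
  rw [inner_sub_left, h, zero_sub, mul_neg, neg_div, mul_div_cancel_right₀ _ hy0.ne'] at this
  convert this using 1
  module

theorem add_mem_pos_of_inner_neg {p q : V} (hp : p ∈ R.Pos) (hq : q ∈ R.Pos)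
    (h : ⟪p, q⟫_ℝ < 0) : p + q ∈ R.Pos := by
  refine R.pos_add p hp q hq (R.add_mem_of_inner_neg (R.pos_subset hp) (R.pos_subset hq) h ?_)
  rintro rfl
  exact R.not_neg_mem q hq hp

theorem add_ne_neg_nsmul {p : V} (hp : p ∈ R.Pos) (n : ℕ) :
    ∀ q ∈ R.Pos, ∀ q' ∈ R.Pos, q + q' ≠ -(n • p) := by
  induction n with
  | zero =>
    intro q hq q' hq' h
    have : q' = -q := by simpa [add_comm, eq_neg_iff_add_eq_zero] using h
    exact R.not_neg_mem q hq (this ▸ hq')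
  | succ n ih =>
    intro q hq q' hq' h
    have hp0 := R.inner_self_pos_of_mem (R.pos_subset hp)
    have hin : ⟪q, p⟫_ℝ + ⟪q', p⟫_ℝ < 0 := by
      rw [← inner_add_left, h, inner_neg_left, ← Nat.cast_smul_eq_nsmul ℝ, real_inner_smul_left]
      have : (0 : ℝ) < (n + 1 : ℕ) := by positivity
      nlinarith
    rw [succ_nsmul] at h
    rcases lt_or_ge ⟪q, p⟫_ℝ 0 with h1 | h1
    · refine ih _ (R.add_mem_pos_of_inner_neg hq hp h1) q' hq' ?_
      rw [add_right_comm, h]; abel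
    · refine ih q hq _ (R.add_mem_pos_of_inner_neg hq' hp (by linarith)) ?_
      rw [← add_assoc, h]; abel

/-- The sum of the positive roots pairs positively with every positive root. -/
theorem exists_inner_pos : ∃ w : V, ∀ p ∈ R.Pos, 0 < ⟪w, p⟫_ℝ := by
  classical
  have hfin : R.Pos.Finite := R.finite.subset R.pos_subset
  refine ⟨∑ q ∈ hfin.toFinset, q, fun p hp => ?_⟩
  have hpΔ := R.pos_subset hp
  have hp0 := R.inner_self_pos_of_mem hpΔ
  have hrefl : ∀ q, reflectRoot p (reflectRoot p q) = q := by
    intro q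
    unfold reflectRoot
    rw [inner_sub_left, real_inner_smul_left, div_mul_cancel₀ _ hp0.ne', sub_sub, ← add_smul,
      ← add_div]
    simp [show 2 * ⟪q, p⟫_ℝ + 2 * (⟪q, p⟫_ℝ - 2 * ⟪q, p⟫_ℝ) = 0 by ring]
  have hinner : ∀ q, ⟪reflectRoot p q, p⟫_ℝ = -⟪q, p⟫_ℝ := by
    intro q
    unfold reflectRoot
    rw [inner_sub_left, real_inner_smul_left, div_mul_cancel₀ _ hp0.ne']
    ring
  rw [sum_inner, ← Finset.sum_filter_add_sum_filter_not _ (fun q => reflectRoot p q ∈ R.Pos)]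
  have h1 : ∑ q ∈ hfin.toFinset with reflectRoot p q ∈ R.Pos, ⟪q, p⟫_ℝ = 0 := by
    have : ∑ q ∈ hfin.toFinset with reflectRoot p q ∈ R.Pos, ⟪q, p⟫_ℝ =
        ∑ q ∈ hfin.toFinset with reflectRoot p q ∈ R.Pos, -⟪q, p⟫_ℝ := by
      refine Finset.sum_bij' (fun q _ => reflectRoot p q) (fun q _ => reflectRoot p q) ?_ ?_ ?_ ?_ ?_
      · intro q hq
        simp only [Finset.mem_filter, Set.Finite.mem_toFinset, hrefl] at hq ⊢
        exact hq.symm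
      · intro q hq
        simp only [Finset.mem_filter, Set.Finite.mem_toFinset, hrefl] at hq ⊢
        exact hq.symm
      · simp [hrefl]
      · simp [hrefl]
      · simp [hinner]
    rw [Finset.sum_neg_distrib] at this
    linarith
  rw [h1, zero_add]
  refine Finset.sum_pos (fun q hq => ?_) ⟨p, ?_⟩
  · simp only [Finset.mem_filter, Set.Finite.mem_toFinset] at hq
    obtain ⟨hq, hq'⟩ := hq
    by_contra! hc
    have hmem : reflectRoot p q ∈ R.Δ := R.reflect_mem q (R.pos_subset hq) p hpΔ
    have hneg : -reflectRoot p q ∈ R.Pos := (R.mem_or_neg _ hmem).resolve_left hq'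
    obtain ⟨n, hn⟩ := R.crystal q (R.pos_subset hq) p hpΔ
    have hn0 : n ≤ 0 := by
      by_contra! hc'
      have : (0 : ℝ) < n := by exact_mod_cast hc'
      nlinarith
    obtain ⟨k, rfl⟩ : ∃ k : ℕ, n = -k := ⟨n.natAbs, by omega⟩
    refine R.add_ne_neg_nsmul hp k q hq _ hneg ?_
    unfold reflectRoot
    rw [hn, mul_div_cancel_right₀ _ hp0.ne', ← Nat.cast_smul_eq_nsmul ℝ]
    push_cast
    module
  · simp only [Finset.mem_filter, Set.Finite.mem_toFinset]
    refine ⟨hp, ?_⟩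
    have : reflectRoot p p = -p := by
      unfold reflectRoot
      rw [mul_div_cancel_right₀ _ hp0.ne']
      module
    rw [this]
    exact R.not_neg_mem p hp

/-- The additive cone generated by the positive roots. -/
def cone : AddSubmonoid V := AddSubmonoid.closure R.Pos

theorem mem_cone_of_mem_pos {p : V} (hp : p ∈ R.Pos) : p ∈ R.cone :=
  AddSubmonoid.subset_closure hp

theorem nonnegComb_iff {x : V} : R.NonnegComb x ↔ x ∈ R.cone := by
  classical
  constructor
  · rintro ⟨c, hc, rfl⟩
    refine AddSubmonoid.sum_mem _ fun α hα => ?_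
    simp only [Nat.cast_smul_eq_nsmul]
    exact nsmul_mem (R.mem_cone_of_mem_pos (hc hα)) _
  · intro hx
    induction hx using AddSubmonoid.closure_induction with
    | mem x hx =>
      refine ⟨Finsupp.single x 1, ?_, ?_⟩
      · intro y hy
        have := Finsupp.support_single_subset hy
        rw [Finset.mem_singleton] at this
        exact this ▸ hx
      · simp
    | zero => exact ⟨0, by simp, by simp⟩
    | add x y _ _ hx hy =>
      obtain ⟨c, hc, rfl⟩ := hx
      obtain ⟨d, hd, rfl⟩ := hy
      refine ⟨c + d, ?_, ?_⟩
      · intro y hy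
        rcases Finset.mem_union.1 (Finsupp.support_add hy) with h | h
        exacts [hc h, hd h]
      · rw [Finsupp.sum_add_index'] <;> intros <;> simp [add_smul]

theorem add_ne_zero_of_mem_cone {p x : V} (hp : p ∈ R.Pos) (hx : x ∈ R.cone) : p + x ≠ 0 := by
  obtain ⟨w, hw⟩ := R.exists_inner_pos
  have h : 0 ≤ ⟪w, x⟫_ℝ := by
    induction hx using AddSubmonoid.closure_induction with
    | mem x hx => exact (hw x hx).le
    | zero => simp
    | add x y _ _ hx hy => rw [inner_add_right]; exact add_nonneg hx hy
  intro h0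
  have := congrArg (fun z => ⟪w, z⟫_ℝ) h0
  simp only [inner_add_right, inner_zero_right] at this
  linarith [hw p hp]

theorem neg_notMem_cone {p : V} (hp : p ∈ R.Pos) : -p ∉ R.cone :=
  fun h => R.add_ne_zero_of_mem_cone hp h (add_neg_cancel p)

theorem cone_eq : R.cone = AddSubmonoid.closure R.Simple := by
  refine le_antisymm (AddSubmonoid.closure_le.2 ?_)
    (AddSubmonoid.closure_mono fun _ h => h.1)
  obtain ⟨w, hw⟩ := R.exists_inner_pos
  by_contra hcon
  obtain ⟨p₀, hp₀⟩ : (R.Pos \ AddSubmonoid.closure R.Simple : Set V).Nonempty := by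
    rw [Set.nonempty_iff_ne_empty, Ne, Set.sdiff_eq_empty]; exact hcon
  obtain ⟨p, ⟨hp, hpS⟩, hmin⟩ := Set.exists_min_image
    (R.Pos \ AddSubmonoid.closure R.Simple : Set V) (fun p => ⟪w, p⟫_ℝ)
    (R.finite.subset fun _ h => R.pos_subset h.1) ⟨p₀, hp₀⟩
  have hns : p ∉ R.Simple := fun h => hpS (AddSubmonoid.subset_closure h)
  have : ∃ β ∈ R.Pos, ∃ γ ∈ R.Pos, p = β + γ := by
    by_contra h
    exact hns ⟨hp, h⟩
  obtain ⟨q, hq, q', hq', rfl⟩ := this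
  have hlt : ∀ r ∈ R.Pos, ⟪w, r⟫_ℝ < ⟪w, q + q'⟫_ℝ → r ∈ AddSubmonoid.closure R.Simple := by
    intro r hr hlt
    by_contra hrS
    exact absurd (hmin r ⟨hr, hrS⟩) (not_le.2 hlt)
  refine hpS (add_mem (hlt q hq ?_) (hlt q' hq' ?_))
  · rw [inner_add_right]; linarith [hw q' hq']
  · rw [inner_add_right]; linarith [hw q hq]

theorem inner_nonpos_of_simple {α α' : V} (hα : α ∈ R.Simple) (hα' : α' ∈ R.Simple)
    (hne : α ≠ α') : ⟪α, α'⟫_ℝ ≤ 0 := by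
  by_contra! h
  have hm := R.sub_mem_of_inner_pos (R.pos_subset hα.1) (R.pos_subset hα'.1) h hne
  rcases R.mem_or_neg _ hm with h1 | h1
  · exact hα.2 ⟨_, h1, _, hα'.1, by abel⟩
  · exact hα'.2 ⟨_, h1, _, hα.1, by abel⟩

theorem linearIndependent_simple : LinearIndependent ℝ ((↑) : R.Simple → V) := by
  classical
  have hfin : R.Simple.Finite := R.finite.subset fun _ h => R.pos_subset h.1
  have := hfin.fintype
  obtain ⟨w, hw⟩ := R.exists_inner_pos
  rw [Fintype.linearIndependent_iff]
  intro g hg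
  have hsum : ∑ i, (g i)⁺ • (i : V) = ∑ i, (g i)⁻ • (i : V) := by
    rw [← sub_eq_zero, ← Finset.sum_sub_distrib, ← hg]
    refine Finset.sum_congr rfl fun i _ => ?_
    rw [← sub_smul, posPart_sub_negPart]
  have hnn : ⟪∑ i, (g i)⁺ • (i : V), ∑ i, (g i)⁺ • (i : V)⟫_ℝ ≤ 0 := by
    nth_rewrite 2 [hsum]
    rw [sum_inner]
    refine Finset.sum_nonpos fun i _ => ?_
    rw [inner_sum]
    refine Finset.sum_nonpos fun j _ => ?_
    rw [real_inner_smul_left, real_inner_smul_right, ← mul_assoc]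
    by_cases hij : i = j
    · subst hij
      rcases le_total 0 (g i) with h | h
      · simp [negPart_eq_zero.2 h]
      · simp [posPart_eq_zero.2 h]
    · exact mul_nonpos_of_nonneg_of_nonpos (mul_nonneg (posPart_nonneg _) (negPart_nonneg _))
        (R.inner_nonpos_of_simple i.2 j.2 fun h => hij (Subtype.ext h))
  have hzero := real_inner_self_nonpos.1 hnn
  have key : ∀ c : R.Simple → ℝ, (∀ i, 0 ≤ c i) → ∑ i, c i • (i : V) = 0 → ∀ i, c i = 0 := by
    intro c hc h i
    have h0 := congrArg (fun z => ⟪w, z⟫_ℝ) h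
    simp only [inner_sum, real_inner_smul_right, inner_zero_right] at h0
    rw [Finset.sum_eq_zero_iff_of_nonneg
      fun i _ => mul_nonneg (hc i) (hw i i.2.1).le] at h0
    exact (mul_eq_zero.1 (h0 i (Finset.mem_univ i))).resolve_right (hw i i.2.1).ne'
  intro i
  rw [← posPart_sub_negPart (g i), key _ (fun i => posPart_nonneg (g i)) hzero i,
    key _ (fun i => negPart_nonneg (g i)) (hsum ▸ hzero) i, sub_zero]

theorem disjoint_span_simple {T : Set V} (hT : T ⊆ R.Simple) :
    Disjoint (Submodule.span ℝ T) (Submodule.span ℝ (R.Simple \ T)) := by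
  have h := R.linearIndependent_simple.disjoint_span_image
    (s := {i | (i : V) ∈ T}) (t := {i | (i : V) ∉ T})
    (Set.disjoint_left.2 fun _ h1 h2 => h2 h1)
  convert h using 2
  · ext x
    simp only [Set.mem_image, Set.mem_ofPred_eq, Subtype.exists, exists_and_left, exists_prop]
    exact ⟨fun h => ⟨x, h, hT h, rfl⟩, by rintro ⟨y, h, _, rfl⟩; exact h⟩
  · ext x
    simp only [Set.mem_image, Set.mem_ofPred_eq, Subtype.exists, exists_and_left, exists_prop]
    exact ⟨fun h => ⟨x, h.2, h.1, rfl⟩, by rintro ⟨y, h, h', rfl⟩; exact ⟨h', h⟩⟩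

theorem exists_add_of_mem_cone {T : Set V} (hT : T ⊆ R.Simple) {x : V} (hx : x ∈ R.cone) :
    ∃ y ∈ AddSubmonoid.closure T, ∃ z ∈ AddSubmonoid.closure (R.Simple \ T), y + z = x := by
  rw [cone_eq, ← Set.union_sdiff_cancel hT, AddSubmonoid.closure_union] at hx
  exact AddSubmonoid.mem_sup.1 hx

end RootSystemData

namespace RootSystemData

variable {V : Type*} [NormedAddCommGroup V] [InnerProductSpace ℝ V] (R : RootSystemData V)

/-- `S` is the root subsystem spanned by a set of simple roots. -/
def IsLevi (S : Set V) : Prop := S = {φ ∈ R.Δ | φ ∈ Submodule.span ℝ (S ∩ R.Simple)}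

variable {R}

theorem IsLevi.mem_iff {S : Set V} (hS : R.IsLevi S) {x : V} :
    x ∈ S ↔ x ∈ R.Δ ∧ x ∈ Submodule.span ℝ (S ∩ R.Simple) := by
  conv_lhs => rw [hS]
  rfl

theorem IsLevi.subset {S : Set V} (hS : R.IsLevi S) : S ⊆ R.Δ := fun _ h => (hS.mem_iff.1 h).1

theorem IsLevi.neg_mem {S : Set V} (hS : R.IsLevi S) {x : V} (hx : x ∈ S) : -x ∈ S :=
  hS.mem_iff.2 ⟨R.neg_mem x (hS.subset hx), Submodule.neg_mem _ (hS.mem_iff.1 hx).2⟩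

theorem IsLevi.add_mem {S : Set V} (hS : R.IsLevi S) {x y : V} (hx : x ∈ S) (hy : y ∈ S)
    (h : x + y ∈ R.Δ) : x + y ∈ S :=
  hS.mem_iff.2 ⟨h, Submodule.add_mem _ (hS.mem_iff.1 hx).2 (hS.mem_iff.1 hy).2⟩

theorem IsLevi.sub_mem {S : Set V} (hS : R.IsLevi S) {x y : V} (hx : x ∈ S) (hy : y ∈ S)
    (h : x - y ∈ R.Δ) : x - y ∈ S :=
  hS.mem_iff.2 ⟨h, Submodule.sub_mem _ (hS.mem_iff.1 hx).2 (hS.mem_iff.1 hy).2⟩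

theorem IsLevi.reflect_mem {S : Set V} (hS : R.IsLevi S) {x y : V} (hx : x ∈ S) (hy : y ∈ S) :
    x - (2 * ⟪x, y⟫_ℝ / ⟪y, y⟫_ℝ) • y ∈ S :=
  hS.mem_iff.2 ⟨R.reflect_mem x (hS.subset hx) y (hS.subset hy),
    Submodule.sub_mem _ (hS.mem_iff.1 hx).2 (Submodule.smul_mem _ _ (hS.mem_iff.1 hy).2)⟩

theorem mem_span_simple {x : V} (hx : x ∈ R.Δ) : x ∈ Submodule.span ℝ R.Simple := by
  have key : ∀ p ∈ R.Pos, p ∈ Submodule.span ℝ R.Simple := by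
    intro p hp
    have h := R.mem_cone_of_mem_pos hp
    rw [cone_eq] at h
    exact (AddSubmonoid.closure_le (S := (Submodule.span ℝ R.Simple).toAddSubmonoid)).2
      Submodule.subset_span h
  rcases R.mem_or_neg x hx with h | h
  · exact key x h
  · simpa using Submodule.neg_mem _ (key _ h)

variable (R) in
theorem isLevi_roots : R.IsLevi R.Δ := by
  have : R.Δ ∩ R.Simple = R.Simple :=
    Set.inter_eq_right.2 fun _ h => R.pos_subset h.1
  unfold IsLevi
  rw [this]
  ext x
  exact ⟨fun h => ⟨h, mem_span_simple h⟩, fun h => h.1⟩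

theorem inner_eq_zero_of_mem_span {A B : Set V} (h : ∀ a ∈ A, ∀ b ∈ B, ⟪a, b⟫_ℝ = 0) {x y : V}
    (hx : x ∈ Submodule.span ℝ A) (hy : y ∈ Submodule.span ℝ B) : ⟪x, y⟫_ℝ = 0 :=
  (Submodule.isOrtho_span (𝕜 := ℝ)).2 (fun a ha b hb => h a ha b hb) |>.inner_eq hx hy

theorem IsLevi.component {S K : Set V} (hS : R.IsLevi S) (hK : IsComponent S K) :
    R.IsLevi K := by
  obtain ⟨hsub, -, horth⟩ := hK
  ext φ
  constructor
  · intro hφ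
    refine ⟨hS.subset (hsub hφ), ?_⟩
    have h1 := (hS.mem_iff.1 (hsub hφ)).2
    have h2 : S ∩ R.Simple = (K ∩ R.Simple) ∪ ((S \ K) ∩ R.Simple) := by
      rw [← Set.union_inter_distrib_right, Set.union_sdiff_cancel hsub]
    rw [h2, Submodule.span_union] at h1
    obtain ⟨y, hy, z, hz, rfl⟩ := Submodule.mem_sup.1 h1
    have hyK : y ∈ Submodule.span ℝ K := Submodule.span_mono Set.inter_subset_left hy
    have hzK : z ∈ Submodule.span ℝ K := by
      simpa using Submodule.sub_mem _ (Submodule.subset_span hφ) hyK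
    have hz0 : ⟪z, z⟫_ℝ = 0 :=
      inner_eq_zero_of_mem_span (fun a ha b hb => horth a ha b hb.1) hzK hz
    rw [inner_self_eq_zero.1 hz0, add_zero]
    exact hy
  · rintro ⟨hφ, hspan⟩
    have hφS : φ ∈ S := hS.mem_iff.2
      ⟨hφ, Submodule.span_mono (Set.inter_subset_inter_left _ hsub) hspan⟩
    by_contra hn
    have : ⟪φ, φ⟫_ℝ = 0 := inner_eq_zero_of_mem_span (B := {φ})
      (fun a ha b hb => horth a ha.1 b (hb ▸ ⟨hφS, hn⟩)) hspan (Submodule.mem_span_singleton_self φ)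
    exact (R.inner_self_pos_of_mem hφ).ne' this

section Highest

variable {S : Set V} {β : V}

theorem IsHighest.add_notMem (hS : R.IsLevi S) (hβ : R.IsHighest S β) {p : V} (hpS : p ∈ S)
    (hp : p ∈ R.Pos) : β + p ∉ R.Δ := by
  intro h
  have := R.nonnegComb_iff.1 (hβ.2.2 _ (hS.add_mem hβ.1 hpS h))
  rw [sub_add_cancel_left] at this
  exact R.neg_notMem_cone hp this

theorem IsHighest.inner_nonneg (hS : R.IsLevi S) (hβ : R.IsHighest S β) {p : V} (hpS : p ∈ S)
    (hp : p ∈ R.Pos) : 0 ≤ ⟪p, β⟫_ℝ := by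
  by_contra! h
  rw [real_inner_comm] at h
  exact hβ.add_notMem hS hpS hp (R.pos_subset (R.add_mem_pos_of_inner_neg hβ.2.1 hp h))

theorem IsHighest.pos_of_inner_pos (hS : R.IsLevi S) (hβ : R.IsHighest S β) {p : V} (hpS : p ∈ S)
    (h : 0 < ⟪p, β⟫_ℝ) : p ∈ R.Pos := by
  refine R.pos_of_neg_notMem (hS.subset hpS) fun hn => ?_
  have := hβ.inner_nonneg hS (hS.neg_mem hpS) hn
  rw [inner_neg_left] at this
  linarith

theorem IsHighest.add_notMem_of_orthogonal (hS : R.IsLevi S) (hβ : R.IsHighest S β) {x : V}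
    (hx : x ∈ S) (h : ⟪x, β⟫_ℝ = 0) : β + x ∉ R.Δ := by
  intro hadd
  rcases R.mem_or_neg x (hS.subset hx) with hp | hp
  · exact hβ.add_notMem hS hx hp hadd
  · refine hβ.add_notMem hS (hS.neg_mem hx) hp ?_
    refine R.add_mem_of_orthogonal (R.neg_mem x (hS.subset hx)) ?_ (by simpa using hadd)
    rw [inner_neg_right, real_inner_comm, h, neg_zero]

theorem IsHighest.sub_notMem_of_orthogonal (hS : R.IsLevi S) (hβ : R.IsHighest S β) {x : V}
    (hx : x ∈ S) (h : ⟪x, β⟫_ℝ = 0) : x - β ∉ R.Δ := by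
  intro hsub
  refine hβ.add_notMem_of_orthogonal hS hx h ?_
  rw [add_comm]
  exact R.add_mem_of_orthogonal (hS.subset hβ.1) h hsub

theorem IsHighest.unique {β' : V} (hβ : R.IsHighest S β) (hβ' : R.IsHighest S β') : β = β' := by
  obtain ⟨w, hw⟩ := R.exists_inner_pos
  have key : ∀ x, x ∈ R.cone → x = 0 ∨ 0 < ⟪w, x⟫_ℝ := by
    intro x hx
    induction hx using AddSubmonoid.closure_induction with
    | mem x hx => exact Or.inr (hw x hx)
    | zero => exact Or.inl rfl
    | add x y _ _ hx hy =>
      rw [inner_add_right]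
      rcases hx with rfl | hx <;> rcases hy with rfl | hy
      · simp
      · simp [hy]
      · simp [hx]
      · exact Or.inr (add_pos hx hy)
  have h1 := key _ (R.nonnegComb_iff.1 (hβ.2.2 _ hβ'.1))
  have h2 := key _ (R.nonnegComb_iff.1 (hβ'.2.2 _ hβ.1))
  rw [inner_sub_right, sub_eq_zero] at h1 h2
  rcases h1 with h1 | h1
  · exact h1
  rcases h2 with h2 | h2
  · exact h2.symm
  · linarith

theorem IsHighest.support_eq (hS : R.IsLevi S) (hβ : R.IsHighest S β) :
    R.support β = S ∩ R.Simple := by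
  ext α
  constructor
  · rintro ⟨hα, hns⟩
    refine ⟨?_, hα⟩
    by_contra hαS
    refine hns (Submodule.span_mono ?_ (hS.mem_iff.1 hβ.1).2)
    rintro x ⟨hx, hx'⟩
    refine ⟨hx', ?_⟩
    rintro rfl
    exact hαS hx
  · rintro ⟨hαS, hα⟩
    refine ⟨hα, fun hspan => ?_⟩
    have hc := R.nonnegComb_iff.1 (hβ.2.2 α hαS)
    obtain ⟨y, hy, z, hz, hyz⟩ := R.exists_add_of_mem_cone (T := R.Simple \ {α})
      Set.sdiff_subset hc
    have hss : R.Simple \ (R.Simple \ {α}) = {α} := by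
      rw [Set.sdiff_sdiff_right_self, Set.inter_eq_right]
      exact Set.singleton_subset_iff.2 hα
    have hd := R.disjoint_span_simple (T := R.Simple \ {α}) Set.sdiff_subset
    rw [hss] at hz hd
    have hy' := Submodule.closure_subset_span (R := ℝ) hy
    have hz' := Submodule.closure_subset_span (R := ℝ) hz
    have h0 : α + z = 0 := by
      refine Submodule.disjoint_def.1 hd _ ?_
        (Submodule.add_mem _ (Submodule.mem_span_singleton_self α) hz')
      have : α + z = β - y := by rw [eq_sub_iff_add_eq, add_assoc, add_comm z, hyz]; abel
      rw [this]
      exact Submodule.sub_mem _ hspan hy'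
    refine R.add_ne_zero_of_mem_cone hα.1 ?_ h0
    exact AddSubmonoid.closure_mono (Set.singleton_subset_iff.2 hα.1) hz

theorem IsHighest.sub_eq (hS : R.IsLevi S) (hβ : R.IsHighest S β) : R.sub β = S := by
  ext φ
  rw [hS.mem_iff, ← hβ.support_eq hS]
  rfl

theorem IsHighest.isLevi_orth (hS : R.IsLevi S) (hβ : R.IsHighest S β) :
    R.IsLevi (R.orth β) := by
  have horth : ∀ {x}, x ∈ R.orth β ↔ x ∈ S ∧ ⟪x, β⟫_ℝ = 0 := by
    intro x
    rw [← hβ.sub_eq hS]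
    rfl
  have hpos : ∀ p ∈ R.Pos, p ∈ S → ⟪p, β⟫_ℝ = 0 →
      p ∈ Submodule.span ℝ (R.orth β ∩ R.Simple) := by
    intro p hp hpS hpβ
    have hT : S ∩ R.Simple ⊆ R.Simple := Set.inter_subset_right
    obtain ⟨y, hy, z, hz, rfl⟩ := R.exists_add_of_mem_cone hT (R.mem_cone_of_mem_pos hp)
    have hyT := Submodule.closure_subset_span (R := ℝ) hy
    have hz0 : z = 0 := by
      refine Submodule.disjoint_def.1 (R.disjoint_span_simple hT) z ?_
        (Submodule.closure_subset_span (R := ℝ) hz)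
      simpa using Submodule.sub_mem _ (hS.mem_iff.1 hpS).2 hyT
    rw [hz0, add_zero] at hpβ ⊢
    have key : 0 ≤ ⟪y, β⟫_ℝ ∧
        (⟪y, β⟫_ℝ = 0 → y ∈ Submodule.span ℝ (R.orth β ∩ R.Simple)) := by
      clear hp hpS hpβ hyT
      induction hy using AddSubmonoid.closure_induction with
      | mem x hx => exact ⟨hβ.inner_nonneg hS hx.1 hx.2.1,
          fun h => Submodule.subset_span ⟨horth.2 ⟨hx.1, h⟩, hx.2⟩⟩
      | zero => simp
      | add x y _ _ hx hy =>
        rw [inner_add_left]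
        refine ⟨add_nonneg hx.1 hy.1, fun h => Submodule.add_mem _ (hx.2 ?_) (hy.2 ?_)⟩
        · linarith [hx.1, hy.1]
        · linarith [hx.1, hy.1]
    exact key.2 hpβ
  ext x
  rw [horth]
  constructor
  · rintro ⟨hx, hxβ⟩
    refine ⟨hS.subset hx, ?_⟩
    rcases R.mem_or_neg x (hS.subset hx) with h | h
    · exact hpos x h hx hxβ
    · simpa using Submodule.neg_mem _ (hpos _ h (hS.neg_mem hx) (by simpa using hxβ))
  · rintro ⟨hx, hspan⟩
    refine ⟨hS.mem_iff.2 ⟨hx, Submodule.span_mono ?_ hspan⟩, ?_⟩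
    · exact fun y hy => ⟨(horth.1 hy.1).1, hy.2⟩
    · exact inner_eq_zero_of_mem_span (fun a ha b hb => hb ▸ (horth.1 ha.1).2) hspan
        (Submodule.mem_span_singleton_self β)

end Highest

theorem exists_component {S : Set V} {φ : V} (hφ : φ ∈ S) : ∃ K, IsComponent S K ∧ φ ∈ K := by
  let r : V → V → Prop := fun x y => y ∈ S ∧ ⟪x, y⟫_ℝ ≠ 0
  refine ⟨{y | Relation.ReflTransGen r φ y}, ⟨?_, ⟨⟨φ, .refl⟩, ?_⟩, ?_⟩, .refl⟩
  · intro y hy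
    induction (show Relation.ReflTransGen r φ y from hy) with
    | refl => exact hφ
    | tail _ h _ => exact h.1
  · rintro ⟨A, B, hAB, hdisj, hA, hB, horth⟩
    have key : ∀ A B : Set V, A ∪ B = {y | Relation.ReflTransGen r φ y} → A ∩ B = ∅ →
        (∀ a ∈ A, ∀ b ∈ B, ⟪a, b⟫_ℝ = 0) → φ ∈ A → B = ∅ := by
      intro A B hAB hdisj horth hφA
      have hall : ∀ y, Relation.ReflTransGen r φ y → y ∈ A := by
        intro y hy
        induction hy with
        | refl => exact hφA
        | @tail y z hyz h ih =>
          have hz : z ∈ A ∪ B := hAB ▸ (hyz.tail h : Relation.ReflTransGen r φ z)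
          exact hz.resolve_right fun hzB => h.2 (horth y ih z hzB)
      refine Set.eq_empty_iff_forall_notMem.2 fun b hb => ?_
      have hb' : b ∈ A ∪ B := Or.inr hb
      rw [hAB] at hb'
      exact Set.eq_empty_iff_forall_notMem.1 hdisj b ⟨hall b hb', hb⟩
    have hφAB : φ ∈ A ∪ B := hAB ▸ (.refl : Relation.ReflTransGen r φ φ)
    rcases hφAB with h | h
    · exact hB.ne_empty (key A B hAB hdisj horth h)
    · refine hA.ne_empty (key B A (by rwa [Set.union_comm]) (by rwa [Set.inter_comm])
        (fun b hb a ha => ?_) h)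
      rw [real_inner_comm]
      exact horth a ha b hb
  · rintro a ha b ⟨hb, hbK⟩
    by_contra h
    exact hbK (Relation.ReflTransGen.tail ha ⟨hb, h⟩)

theorem component_subset {S K K' : Set V} (hK : IsComponent S K) (hK' : IsComponent S K')
    {x : V} (hx : x ∈ K) (hx' : x ∈ K') : K ⊆ K' := by
  by_contra h
  obtain ⟨y, hy, hy'⟩ := Set.not_subset.1 h
  exact hK.2.1.2 ⟨K ∩ K', K \ K', Set.inter_union_sdiff _ _,
    by ext; simp; tauto, ⟨x, hx, hx'⟩, ⟨y, hy, hy'⟩,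
    fun a ha b hb => hK'.2.2 a ha.2 b ⟨hK.1 hb.1, hb.2⟩⟩

theorem component_eq {S K K' : Set V} (hK : IsComponent S K) (hK' : IsComponent S K')
    {x : V} (hx : x ∈ K) (hx' : x ∈ K') : K = K' :=
  (component_subset hK hK' hx hx').antisymm (component_subset hK' hK hx' hx)

theorem IsLevi.exists_inner_ne_zero {K : Set V} (hK : R.IsLevi K) (hirr : IsIrred K) {m ψ : V}
    (hm : m ∈ K) (hψ : ψ ∈ K) (h : ⟪ψ, m⟫_ℝ = 0) :
    ∃ e ∈ K, ⟪e, m⟫_ℝ ≠ 0 ∧ ⟪ψ, e⟫_ℝ ≠ 0 := by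
  by_contra hcon
  let A : Set V := {x ∈ K | ⟪x, m⟫_ℝ ≠ 0 ∨ ∃ e ∈ K, ⟪e, m⟫_ℝ ≠ 0 ∧ ⟪x, e⟫_ℝ ≠ 0}
  refine hirr.2 ⟨A, K \ A, Set.union_sdiff_cancel fun _ h => h.1, by ext; simp,
    ⟨m, hm, Or.inl (R.inner_self_pos_of_mem (hK.subset hm)).ne'⟩,
    ⟨ψ, hψ, fun h' => h'.2.elim (fun h' => h' h) hcon⟩, ?_⟩
  rintro a ⟨haK, ha⟩ b ⟨hbK, hbA⟩
  have hb : ∀ e ∈ K, ⟪e, m⟫_ℝ ≠ 0 → ⟪b, e⟫_ℝ = 0 := by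
    intro e he hem
    by_contra hne
    exact hbA ⟨hbK, Or.inr ⟨e, he, hem, hne⟩⟩
  rw [real_inner_comm]
  by_cases ham : ⟪a, m⟫_ℝ = 0
  · obtain ⟨e, he, hem, hae⟩ := ha.resolve_left (not_not.2 ham)
    have h1 := hb e he hem
    have h2 := hb _ (hK.reflect_mem he haK) (by
      rwa [inner_sub_left, real_inner_smul_left, ham, mul_zero, sub_zero])
    rw [inner_sub_right, real_inner_smul_right, h1, zero_sub, neg_eq_zero] at h2
    refine (mul_eq_zero.1 h2).resolve_left ?_
    rw [real_inner_comm] at hae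
    exact div_ne_zero (mul_ne_zero two_ne_zero hae)
      (R.inner_self_pos_of_mem (hK.subset haK)).ne'
  · exact hb a haK ham

theorem IsLevi.exists_isHighest {K : Set V} (hK : R.IsLevi K) (hirr : IsIrred K) :
    ∃ β, R.IsHighest K β := by
  obtain ⟨w, hw⟩ := R.exists_inner_pos
  obtain ⟨m, hm, hmax⟩ := Set.exists_max_image K (fun x => ⟪w, x⟫_ℝ)
    (R.finite.subset hK.subset) hirr.1
  have hadd : ∀ p ∈ R.Pos, m + p ∉ K := by
    intro p hp h
    have := hmax _ h
    rw [inner_add_right] at this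
    linarith [hw p hp]
  have hmpos : m ∈ R.Pos := by
    refine R.pos_of_neg_notMem (hK.subset hm) fun h => ?_
    have h1 := hmax _ (hK.neg_mem hm)
    have h2 := hw _ h
    rw [inner_neg_right] at h1 h2
    linarith
  have hdom : ∀ p ∈ R.Pos, p ∈ K → 0 ≤ ⟪p, m⟫_ℝ := by
    intro p hp hpK
    by_contra! h
    rw [real_inner_comm] at h
    exact hadd p hp (hK.add_mem hm hpK (R.pos_subset (R.add_mem_pos_of_inner_neg hmpos hp h)))
  have hpos : ∀ p ∈ K, 0 < ⟪p, m⟫_ℝ → p ∈ R.Pos := by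
    intro p hpK h
    refine R.pos_of_neg_notMem (hK.subset hpK) fun hn => ?_
    have := hdom _ hn (hK.neg_mem hpK)
    rw [inner_neg_left] at this
    linarith
  have hle : ∀ p ∈ K, 0 < ⟪p, m⟫_ℝ → m - p ∈ R.cone := by
    intro p hpK h
    by_cases hne : m = p
    · rw [hne, sub_self]; exact zero_mem _
    have hsub : m - p ∈ R.Δ :=
      R.sub_mem_of_inner_pos (hK.subset hm) (hK.subset hpK) (by rwa [real_inner_comm]) hne
    refine R.mem_cone_of_mem_pos (R.pos_of_neg_notMem hsub fun hn => hadd _ hn ?_)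
    simpa using hpK
  refine ⟨m, hm, hmpos, fun ψ hψ => R.nonnegComb_iff.2 ?_⟩
  rcases R.mem_or_neg ψ (hK.subset hψ) with hψp | hψn
  swap
  · rw [sub_eq_add_neg]
    exact R.cone.add_mem (R.mem_cone_of_mem_pos hmpos) (R.mem_cone_of_mem_pos hψn)
  rcases (hdom ψ hψp hψ).lt_or_eq with h | h
  · exact hle ψ hψ h
  have key : ∀ e ∈ K, 0 < ⟪e, m⟫_ℝ → ⟪ψ, e⟫_ℝ ≠ 0 → m - ψ ∈ R.cone := by
    intro e he hem hne
    have he' := hK.reflect_mem he hψ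
    have hψ0 := R.inner_self_pos_of_mem (hK.subset hψ)
    obtain ⟨n, hn⟩ := R.crystal e (hK.subset he) ψ (hK.subset hψ)
    rw [hn, mul_div_cancel_right₀ _ hψ0.ne'] at he'
    have hem' : 0 < ⟪e - (n : ℝ) • ψ, m⟫_ℝ := by
      rwa [inner_sub_left, real_inner_smul_left, ← h, mul_zero, sub_zero]
    have hn0 : n ≠ 0 := by
      rintro rfl
      rw [Int.cast_zero, zero_mul, real_inner_comm] at hn
      exact hne (by linarith)
    have hψc := R.mem_cone_of_mem_pos hψp
    rcases lt_or_gt_of_ne hn0 with hneg | hgt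
    · obtain ⟨k, rfl⟩ : ∃ k : ℕ, n = -(k + 1) := ⟨(-n - 1).toNat, by omega⟩
      have := R.cone.add_mem (R.cone.add_mem (hle _ he' hem') (R.mem_cone_of_mem_pos (hpos e he hem)))
        (nsmul_mem hψc k)
      convert this using 1
      rw [← Nat.cast_smul_eq_nsmul ℝ]
      push_cast
      module
    · obtain ⟨k, rfl⟩ : ∃ k : ℕ, n = k + 1 := ⟨(n - 1).toNat, by omega⟩
      have := R.cone.add_mem (R.cone.add_mem (hle _ he hem) (R.mem_cone_of_mem_pos (hpos _ he' hem')))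
        (nsmul_mem hψc k)
      convert this using 1
      rw [← Nat.cast_smul_eq_nsmul ℝ]
      push_cast
      module
  obtain ⟨e, he, hem, hne⟩ := hK.exists_inner_ne_zero hirr hm hψ h.symm
  rcases lt_or_gt_of_ne hem with h' | h'
  · exact key _ (hK.neg_mem he) (by simpa using h') (by simpa using hne)
  · exact key e he h' hne

end RootSystemData

namespace RootSystemData

variable {V : Type*} [NormedAddCommGroup V] [InnerProductSpace ℝ V] {R : RootSystemData V}

variable (R) in
/-- The members of the chain cascades that start inside the root subsystem `S`. -/
inductive CascadeBelow : Set V → V → Prop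
  | highest {S K : Set V} {β : V} : IsComponent S K → R.IsHighest K β → CascadeBelow S β
  | step {S K : Set V} {γ β : V} : IsComponent S K → R.IsHighest K γ →
      CascadeBelow (R.orth γ) β → CascadeBelow S β

theorem cascadeBelow_of_chain (l : List V) : ∀ (S : Set V) (b : V),
    (∃ K, IsComponent S K ∧ R.IsHighest K b) →
    (b :: l).IsChain (fun γ δ => ∃ K, IsComponent (R.orth γ) K ∧ R.IsHighest K δ) →
    ∀ β ∈ b :: l, R.CascadeBelow S β := by
  induction l with
  | nil =>
    rintro S b ⟨K, hK, hb⟩ - β hβ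
    rw [List.mem_singleton] at hβ
    exact hβ ▸ .highest hK hb
  | cons c l ih =>
    rintro S b ⟨K, hK, hb⟩ hchain β hβ
    rw [List.isChain_cons_cons] at hchain
    rcases List.mem_cons.1 hβ with rfl | hβ
    · exact .highest hK hb
    · exact .step hK hb (ih _ c hchain.1 hchain.2 β hβ)

theorem CascadeBelow.exists_chain {S : Set V} {β : V} (h : R.CascadeBelow S β) :
    ∃ b l, (∃ K, IsComponent S K ∧ R.IsHighest K b) ∧
      (b :: l).IsChain (fun γ δ => ∃ K, IsComponent (R.orth γ) K ∧ R.IsHighest K δ) ∧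
      β ∈ b :: l := by
  induction h with
  | @highest S K β hK hβ => exact ⟨β, [], ⟨K, hK, hβ⟩, by simp, by simp⟩
  | @step S K γ β hK hγ _ ih =>
    obtain ⟨b, l, hb, hchain, hmem⟩ := ih
    exact ⟨γ, b :: l, ⟨K, hK, hγ⟩, List.isChain_cons_cons.2 ⟨hb, hchain⟩,
      List.mem_cons_of_mem _ hmem⟩

theorem mem_cascade_iff {β : V} : β ∈ R.cascade ↔ R.CascadeBelow R.Δ β := by
  constructor
  · rintro ⟨l, ⟨hne, hhead, hchain⟩, hβ⟩
    cases l with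
    | nil => exact absurd rfl hne
    | cons b l => exact cascadeBelow_of_chain l _ b (hhead b (by simp)) hchain β hβ
  · intro h
    obtain ⟨b, l, hb, hchain, hmem⟩ := h.exists_chain
    refine ⟨b :: l, ⟨by simp, ?_, hchain⟩, hmem⟩
    rintro b' hb'
    simp only [List.head?_cons, Option.mem_def, Option.some.injEq] at hb'
    exact hb' ▸ hb

theorem CascadeBelow.isLevi_sub {S : Set V} {β : V} (h : R.CascadeBelow S β) (hS : R.IsLevi S) :
    R.IsLevi (R.sub β) ∧ R.IsHighest (R.sub β) β ∧ R.sub β ⊆ S := by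
  induction h with
  | @highest S K β hK hβ =>
    have hKL := hS.component hK
    rw [hβ.sub_eq hKL]
    exact ⟨hKL, hβ, hK.1⟩
  | @step S K γ β hK hγ _ ih =>
    have hKL := hS.component hK
    obtain ⟨h1, h2, h3⟩ := ih (hγ.isLevi_orth hKL)
    refine ⟨h1, h2, fun x hx => hK.1 ?_⟩
    rw [← hγ.sub_eq hKL]
    exact (h3 hx).1

theorem isLevi_sub_of_mem_cascade {β : V} (h : β ∈ R.cascade) : R.IsLevi (R.sub β) :=
  ((mem_cascade_iff.1 h).isLevi_sub (isLevi_roots R)).1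

theorem isHighest_of_mem_cascade {β : V} (h : β ∈ R.cascade) : R.IsHighest (R.sub β) β :=
  ((mem_cascade_iff.1 h).isLevi_sub (isLevi_roots R)).2.1

theorem sub_notMem_of_component_ne {S K K' : Set V} (hS : R.IsLevi S) (hK : IsComponent S K)
    (hK' : IsComponent S K') (hne : K ≠ K') {x y : V} (hx : x ∈ K) (hy : y ∈ K') :
    x - y ∉ R.Δ := by
  intro h
  have hxy : ⟪x, y⟫_ℝ = 0 :=
    hK.2.2 x hx y ⟨hK'.1 hy, fun hyK => hne (component_eq hK hK' hyK hy)⟩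
  have hmem : x - y ∈ S := hS.sub_mem (hK.1 hx) (hK'.1 hy) h
  have h1 : x - y ∈ K := by
    by_contra hn
    have := hK.2.2 x hx _ ⟨hmem, hn⟩
    rw [inner_sub_right, hxy, sub_zero] at this
    exact (R.inner_self_pos_of_mem (hS.subset (hK.1 hx))).ne' this
  have h2 : x - y ∈ K' := by
    by_contra hn
    have := hK'.2.2 y hy _ ⟨hmem, hn⟩
    rw [inner_sub_right, real_inner_comm, hxy, zero_sub, neg_eq_zero] at this
    exact (R.inner_self_pos_of_mem (hS.subset (hK'.1 hy))).ne' this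
  exact hne (component_eq hK hK' h1 h2)

theorem CascadeBelow.sub_mem_pos {S : Set V} {β : V} (h : R.CascadeBelow S β) (hS : R.IsLevi S) :
    ∀ β', R.CascadeBelow S β' → β' ≠ β → ∀ φ ∈ R.E β, φ - β' ∈ R.Δ → φ - β' ∈ R.Pos := by
  have hcomp : ∀ {S K K' : Set V} {c c' φ β' : V}, R.IsLevi S → IsComponent S K →
      R.IsHighest K c → φ ∈ K → IsComponent S K' → R.IsHighest K' c' → β' ∈ K' →
      φ - β' ∈ R.Δ → K = K' ∧ c = c' := by
    intro S K K' c c' φ β' hS hK hc hφ hK' hc' hβ' hsub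
    by_cases hKK : K = K'
    · subst hKK
      exact ⟨rfl, hc.unique hc'⟩
    · exact absurd hsub (sub_notMem_of_component_ne hS hK hK' hKK hφ hβ')
  have hbelow : ∀ {K : Set V} {γ β : V}, R.IsLevi K → R.IsHighest K γ →
      R.CascadeBelow (R.orth γ) β → R.sub β ⊆ R.orth γ ∧ R.sub β ⊆ K ∧ β ∈ R.sub β := by
    intro K γ β hK hγ hβ
    obtain ⟨-, h2, h3⟩ := hβ.isLevi_sub (hγ.isLevi_orth hK)
    refine ⟨h3, fun x hx => ?_, h2.1⟩
    rw [← hγ.sub_eq hK]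
    exact (h3 hx).1
  induction h with
  | @highest S K c hK hc =>
    intro β' h' hne φ hφ hsub
    have hKL := hS.component hK
    have hφK : φ ∈ K := hc.sub_eq hKL ▸ hφ.1
    cases h' with
    | @highest _ K' c' hK' hc' =>
      exact absurd (hcomp hS hK hc hφK hK' hc' hc'.1 hsub).2 hne.symm
    | @step _ K' c' _ hK' hc' hβ' =>
      have hb := hbelow (hS.component hK') hc' hβ'
      obtain ⟨rfl, rfl⟩ := hcomp hS hK hc hφK hK' hc' (hb.2.1 hb.2.2) hsub
      refine hc.pos_of_inner_pos hKL (hKL.sub_mem hφK (hb.2.1 hb.2.2) hsub) ?_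
      rw [inner_sub_left, (hb.1 hb.2.2).2, sub_zero]
      exact hφ.2
  | @step S K c β hK hc hβ ih =>
    intro β' h' hne φ hφ hsub
    have hKL := hS.component hK
    have hb := hbelow hKL hc hβ
    cases h' with
    | @highest _ K' c' hK' hc' =>
      obtain ⟨rfl, rfl⟩ := hcomp hS hK hc (hb.2.1 hφ.1) hK' hc' hc'.1 hsub
      exact absurd hsub (hc.sub_notMem_of_orthogonal hKL (hb.2.1 hφ.1) (hb.1 hφ.1).2)
    | @step _ K' c' _ hK' hc' hβ' =>
      have hb' := hbelow (hS.component hK') hc' hβ'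
      obtain ⟨rfl, rfl⟩ := hcomp hS hK hc (hb.2.1 hφ.1) hK' hc' (hb'.2.1 hb'.2.2) hsub
      exact ih (hc.isLevi_orth hKL) β' hβ' hne φ hφ hsub

theorem IsLevi.exists_cascadeBelow (n : ℕ) : ∀ {S : Set V}, R.IsLevi S → S.ncard ≤ n →
    ∀ φ ∈ S, φ ∈ R.Pos → ∃ β, R.CascadeBelow S β ∧ φ ∈ R.E β := by
  induction n with
  | zero =>
    intro S hS hn φ hφ _
    have := (Set.ncard_eq_zero (R.finite.subset hS.subset)).1 (Nat.le_zero.1 hn)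
    simp [this] at hφ
  | succ n ih =>
    intro S hS hn φ hφ hp
    obtain ⟨K, hK, hφK⟩ := exists_component hφ
    have hKL := hS.component hK
    obtain ⟨β, hβ⟩ := hKL.exists_isHighest hK.2.1
    have hsub := hβ.sub_eq hKL
    rcases (hβ.inner_nonneg hKL hφK hp).lt_or_eq with h | h
    · exact ⟨β, .highest hK hβ, hsub ▸ hφK, h⟩
    · have hss : R.orth β ⊂ S := by
        refine ⟨fun x hx => hK.1 (hsub ▸ hx.1), fun hle => ?_⟩
        exact (R.inner_self_pos_of_mem (R.pos_subset hβ.2.1)).ne' (hle (hK.1 hβ.1)).2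
      have hlt := Set.ncard_lt_ncard hss (R.finite.subset hS.subset)
      obtain ⟨β', hβ', hφ'⟩ := ih (hβ.isLevi_orth hKL) (by omega) φ
        ⟨hsub ▸ hφK, h.symm⟩ hp
      exact ⟨β', .step hK hβ hβ', hφ'⟩

theorem exists_mem_cascade_mem_E {φ : V} (hφ : φ ∈ R.Pos) : ∃ β ∈ R.cascade, φ ∈ R.E β := by
  obtain ⟨β, hβ, h⟩ :=
    (isLevi_roots R).exists_cascadeBelow _ le_rfl φ (R.pos_subset hφ) hφ
  exact ⟨β, mem_cascade_iff.2 hβ, h⟩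

theorem sub_mem_pos_of_mem_cascade {β β' φ : V} (hβ : β ∈ R.cascade) (hβ' : β' ∈ R.cascade)
    (hne : β' ≠ β) (hφ : φ ∈ R.E β) (h : φ - β' ∈ R.Δ) : φ - β' ∈ R.Pos :=
  (mem_cascade_iff.1 hβ).sub_mem_pos (isLevi_roots R) β' (mem_cascade_iff.1 hβ') hne φ hφ h

theorem mem_E_self {β : V} (hβ : β ∈ R.cascade) : β ∈ R.E β :=
  ⟨(isHighest_of_mem_cascade hβ).1,
    R.inner_self_pos_of_mem (R.pos_subset (isHighest_of_mem_cascade hβ).2.1)⟩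

theorem pos_of_mem_E {β φ : V} (hβ : β ∈ R.cascade) (hφ : φ ∈ R.E β) : φ ∈ R.Pos :=
  (isHighest_of_mem_cascade hβ).pos_of_inner_pos (isLevi_sub_of_mem_cascade hβ) hφ.1 hφ.2

theorem sub_mem_E {β φ : V} (hβ : β ∈ R.cascade) (hφ : φ ∈ R.E β) (hne : φ ≠ β) :
    β - φ ∈ R.E β := by
  have hL := isLevi_sub_of_mem_cascade hβ
  have hH := isHighest_of_mem_cascade hβ
  have hΔ : β - φ ∈ R.Δ :=
    R.sub_mem_of_inner_pos (R.pos_subset hH.2.1) (hL.subset hφ.1)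
      (by rw [real_inner_comm]; exact hφ.2) hne.symm
  have hmem : β - φ ∈ R.sub β := hL.sub_mem hH.1 hφ.1 hΔ
  have hpos : β - φ ∈ R.Pos := by
    refine R.pos_of_neg_notMem hΔ fun hn => R.neg_notMem_cone hn ?_
    rw [neg_neg]
    exact R.nonnegComb_iff.1 (hH.2.2 φ hφ.1)
  refine ⟨hmem, (hH.inner_nonneg hL hmem hpos).lt_of_ne fun h => ?_⟩
  refine hH.sub_notMem_of_orthogonal hL hmem h.symm ?_
  rw [sub_sub_cancel_left]
  exact R.neg_mem _ (hL.subset hφ.1)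

theorem eq_of_mem_E {β β' ψ : V} (hβ : β ∈ R.cascade) (hβ' : β' ∈ R.cascade)
    (h : ψ ∈ R.E β) (h' : ψ ∈ R.E β') : β = β' := by
  by_contra hne
  have key : ∀ β β', β ∈ R.cascade → β' ∈ R.cascade → ψ ∈ R.E β → ψ ∈ R.E β' →
      β ≠ β' → ψ = β' := by
    intro β β' hβ hβ' h h' hne
    by_contra hψ
    have h1 := pos_of_mem_E hβ' (sub_mem_E hβ' h' hψ)
    have h2 := sub_mem_pos_of_mem_cascade hβ hβ' hne.symm h
      (by simpa using R.neg_mem _ (R.pos_subset h1))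
    exact R.not_neg_mem _ h1 (by simpa using h2)
  exact hne ((key β' β hβ' hβ h' h (Ne.symm hne)).symm.trans (key β β' hβ hβ' h h' hne))

theorem sub_notMem_cascade {β φ : V} (hβ : β ∈ R.cascade) (hφ : φ ∈ R.E β) (hne : φ ≠ β) :
    β - φ ∉ R.cascade := by
  intro hc
  have := eq_of_mem_E hβ hc (sub_mem_E hβ hφ hne) (mem_E_self hc)
  exact R.ne_zero_of_mem (R.pos_subset (pos_of_mem_E hβ hφ)) (sub_eq_self.1 this.symm)

end RootSystemData

namespace CascadeLieData

variable {V : Type*} [NormedAddCommGroup V] [InnerProductSpace ℝ V]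
  {L : Type*} [LieRing L] [LieAlgebra ℂ L]
  (C : CascadeLieData V L)

open RootSystemData

theorem Φ_bracket_eq_zero {φ β β' : V} (hβ : β ∈ C.cascade) (hβ' : β' ∈ C.cascade)
    (hne : β' ≠ β) (hφ : φ ∈ C.E β) (hφc : φ ∉ C.cascade) :
    C.Φ ⁅C.e φ, C.e (-β')⁆ = 0 := by
  have hφΔ : φ ∈ C.Δ := C.pos_subset (pos_of_mem_E hβ hφ)
  have hβΔ : -β' ∈ C.Δ := C.neg_mem _ (C.pos_subset (pos_of_mem_E hβ' (mem_E_self hβ')))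
  by_cases h : φ + -β' ∈ C.Δ
  · obtain ⟨c, -, hc⟩ := C.bracket_add φ hφΔ _ hβΔ h
    rw [hc, map_smul, C.Φ_b, smul_zero]
    refine Submodule.mem_sup_right (Submodule.subset_span ⟨_, ?_, rfl⟩)
    rw [← sub_eq_add_neg] at h ⊢
    exact sub_mem_pos_of_mem_cascade hβ hβ' hne hφ h
  · rw [C.bracket_zero φ hφΔ _ hβΔ h ?_, map_zero]
    rw [← sub_eq_add_neg, sub_ne_zero]
    rintro rfl
    exact hφc hβ'

theorem exists_Φ_bracket_eq_smul {φ β : V} (hβ : β ∈ C.cascade) (hφ : φ ∈ C.E β) (hne : φ ≠ β) :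
    ∃ c : ℂ, c ≠ 0 ∧ C.Φ ⁅C.e φ, C.e (-β)⁆ = c • C.e (-(β - φ)) := by
  have hφΔ : φ ∈ C.Δ := C.pos_subset (pos_of_mem_E hβ hφ)
  have hβΔ : -β ∈ C.Δ := C.neg_mem _ (C.pos_subset (pos_of_mem_E hβ (mem_E_self hβ)))
  have hpos := pos_of_mem_E hβ (sub_mem_E hβ hφ hne)
  have heq : φ + -β = -(β - φ) := by abel
  obtain ⟨c, hc0, hc⟩ := C.bracket_add φ hφΔ _ hβΔ (heq ▸ C.neg_mem _ (C.pos_subset hpos))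
  refine ⟨c, hc0, ?_⟩
  rw [hc, heq, map_smul, C.Φ_neg _ (Submodule.subset_span ⟨_, ⟨_, hpos, rfl⟩, rfl⟩)]

/-- Bracketing `e_φ` with a generic element of `𝔯₋` and projecting gives a nonzero multiple
of `e_{-(β - φ)}`, where `β` is the cascade root with `φ ∈ E(β)`. -/
theorem exists_Φ_bracket_rMinusX {τ : L} (hτ : τ ∈ C.rMinusX) {φ β : V} (hβ : β ∈ C.cascade)
    (hφ : φ ∈ C.E β) (hφc : φ ∉ C.cascade) :
    ∃ c : ℂ, c ≠ 0 ∧ C.Φ ⁅C.e φ, τ⁆ = c • C.e (-(β - φ)) := by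
  have hfin : C.cascade.Finite :=
    C.finite.subset fun β hβ => C.pos_subset (pos_of_mem_E hβ (mem_E_self hβ))
  obtain ⟨a, ha, rfl⟩ := hτ
  obtain ⟨c, hc, hbr⟩ := C.exists_Φ_bracket_eq_smul hβ hφ (fun h => hφc (h ▸ hβ))
  refine ⟨a β * c, mul_ne_zero (ha β hβ) hc, ?_⟩
  rw [finsum_mem_eq_finite_toFinset_sum _ hfin, lie_sum, map_sum,
    Finset.sum_eq_single_of_mem β (hfin.mem_toFinset.2 hβ)]
  · rw [lie_smul, map_smul, hbr, smul_smul]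
  · intro β' hβ' hne
    rw [lie_smul, map_smul, C.Φ_bracket_eq_zero hβ (hfin.mem_toFinset.1 hβ') hne hφ hφc,
      smul_zero]

end CascadeLieData

/-- If `0 ≠ v ∈ 𝔰` and `τ ∈ 𝔯₋ˣ`, then `Φ([v,τ]) ≠ 0` and
`Φ([v,τ]) ∈ 𝔰₋`. -/
theorem statement13 {V : Type*} [NormedAddCommGroup V] [InnerProductSpace ℝ V]
    {L : Type*} [LieRing L] [LieAlgebra ℂ L] [Module.Finite ℂ L]
    (C : CascadeLieData V L) (v : L) (hv : v ∈ C.sSub) (hv0 : v ≠ 0)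
    (τ : L) (hτ : τ ∈ C.rMinusX) :
    C.Φ ⁅v, τ⁆ ≠ 0 ∧ C.Φ ⁅v, τ⁆ ∈ C.sMinus := by
  classical
  let T : Set V := C.Pos \ C.toRootSystemData.cascade
  have hT : T.Finite := C.finite.subset fun _ h => C.pos_subset h.1
  have := hT.fintype
  have hex : ∀ φ : T, ∃ β ∈ C.toRootSystemData.cascade, (φ : V) ∈ C.toRootSystemData.E β :=
    fun φ => RootSystemData.exists_mem_cascade_mem_E φ.2.1
  choose b hb hE using hex
  have hne : ∀ φ : T, (φ : V) ≠ b φ := fun φ h => φ.2.2 (h ▸ hb φ)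
  choose d hd hΦ using fun φ : T => C.exists_Φ_bracket_rMinusX hτ (hb φ) (hE φ) φ.2.2
  have hsub := fun φ : T => RootSystemData.sub_mem_E (hb φ) (hE φ) (hne φ)
  have hpos := fun φ : T => RootSystemData.pos_of_mem_E (hb φ) (hsub φ)
  have hspan : v ∈ Submodule.span ℂ (Set.range fun φ : T => C.e φ) := by
    rw [← Set.image_eq_range]
    exact hv
  obtain ⟨c, rfl⟩ := (Submodule.mem_span_range_iff_exists_fun ℂ).1 hspan
  have hval : C.Φ ⁅∑ φ : T, c φ • C.e φ, τ⁆ = ∑ φ : T, (c φ * d φ) • C.e (-(b φ - φ)) := by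
    rw [sum_lie, map_sum]
    refine Finset.sum_congr rfl fun φ _ => ?_
    rw [smul_lie, map_smul, hΦ, smul_smul]
  have hind : LinearIndependent ℂ fun φ : T => C.e (-(b φ - φ)) := by
    refine C.indep.comp (fun φ : T => ⟨-(b φ - φ), C.neg_mem _ (C.pos_subset (hpos φ))⟩) ?_
    intro φ φ' h
    have h1 : b φ - (φ : V) = b φ' - φ' := neg_injective (congrArg Subtype.val h)
    have h2 : b φ = b φ' :=
      RootSystemData.eq_of_mem_E (hb φ) (hb φ') (hsub φ) (h1 ▸ hsub φ')
    rw [h2] at h1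
    exact Subtype.ext (sub_right_injective h1)
  rw [hval]
  constructor
  · intro h0
    refine hv0 (Finset.sum_eq_zero fun φ _ => ?_)
    have := Fintype.linearIndependent_iff.1 hind _ h0 φ
    rw [(mul_eq_zero.1 this).resolve_right (hd φ), zero_smul]
  · refine Submodule.sum_mem _ fun φ _ => Submodule.smul_mem _ _ (Submodule.subset_span ?_)
    exact ⟨_, ⟨_, ⟨hpos φ, RootSystemData.sub_notMem_cascade (hb φ) (hE φ) (hne φ)⟩, rfl⟩, rfl⟩
end

section
/- Let K be a field of characteristic zero, let A = K[x₁,…,x_n] be a polynomial algebra with fraction field F, and let D be a locally nilpotent K-derivation of A (for each a ∈ A there exists N with D^N(a) = 0), extended uniquely to a derivation of F. Then every f ∈ F with D(f) = 0 can be written as f = p/q with p, q ∈ A, q ≠ 0, and D(p) = D(q) = 0; that is, the field of D-constants of F is the fraction field of the ring of D-constants of A. -/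
/-- If `D` extends to `D'` and `f` is a constant of `D'`, a relation `a = f * b` passes to the iterates
of `D`. -/
theorem Derivation.algebraMap_iterate_eq_mul {K A F : Type*} [CommSemiring K] [CommSemiring A]
    [CommSemiring F] [Algebra K A] [Algebra K F] [Algebra A F] (D : Derivation K A A)
    (D' : Derivation K F F) (hD' : ∀ a : A, D' (algebraMap A F a) = algebraMap A F (D a))
    {f : F} (hf : D' f = 0) {a b : A} (hab : algebraMap A F a = f * algebraMap A F b) (k : ℕ) :
    algebraMap A F ((⇑D)^[k] a) = f * algebraMap A F ((⇑D)^[k] b) := by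
  induction k with
  | zero => exact hab
  | succ k ih =>
    rw [Function.iterate_succ_apply', Function.iterate_succ_apply', ← hD', ih, D'.leibniz, hf,
      hD', smul_zero, add_zero, smul_eq_mul]

/-- If some iterate of `g` kills `b ≠ 0`, then `g` kills the last nonzero iterate `g^[k] b`. -/
theorem Function.exists_iterate_ne_zero_of_iterate_eq_zero {A : Type*} [Zero A] {g : A → A}
    {b : A} (hb : b ≠ 0) (h : ∃ N : ℕ, g^[N] b = 0) :
    ∃ k : ℕ, g^[k] b ≠ 0 ∧ g (g^[k] b) = 0 := by
  classical
  obtain ⟨k, hk⟩ : ∃ k, Nat.find h = k + 1 :=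
    Nat.exists_eq_succ_of_ne_zero fun h0 => hb (by simpa [h0] using Nat.find_spec h)
  refine ⟨k, Nat.find_min h (by omega), ?_⟩
  rw [← Function.iterate_succ_apply' g, Nat.succ_eq_add_one, ← hk]
  exact Nat.find_spec h

/-- Let `K` be a field of characteristic zero, `A = K[x₁,…,xₙ]` a
polynomial algebra with fraction field `F`, and `D` a locally nilpotent `K`-derivation of
`A`, extended (uniquely) to a derivation `D'` of `F`.  Then every `f ∈ F` with `D' f = 0`
can be written as `f = p/q` with `p, q ∈ A`, `q ≠ 0` and `D p = D q = 0`: the field of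
`D`-constants of `F` is the fraction field of the ring of `D`-constants of `A`. -/
theorem statement15 (K : Type*) [Field K] [CharZero K] (n : ℕ)
    (D : Derivation K (MvPolynomial (Fin n) K) (MvPolynomial (Fin n) K))
    (hD : ∀ a : MvPolynomial (Fin n) K, ∃ N : ℕ, (⇑D)^[N] a = 0)
    (F : Type*) [Field F] [Algebra K F] [Algebra (MvPolynomial (Fin n) K) F]
    [IsScalarTower K (MvPolynomial (Fin n) K) F]
    [IsFractionRing (MvPolynomial (Fin n) K) F]
    (D' : Derivation K F F)
    (hD' : ∀ a : MvPolynomial (Fin n) K,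
      D' (algebraMap (MvPolynomial (Fin n) K) F a) = algebraMap (MvPolynomial (Fin n) K) F (D a)) :
    ∀ f : F, D' f = 0 → ∃ p q : MvPolynomial (Fin n) K, q ≠ 0 ∧ D p = 0 ∧ D q = 0 ∧
      f = algebraMap (MvPolynomial (Fin n) K) F p / algebraMap (MvPolynomial (Fin n) K) F q := by
  intro f hf
  obtain ⟨a, b, hb, rfl⟩ := IsFractionRing.div_surjective (A := MvPolynomial (Fin n) K) f
  have hb0 : b ≠ 0 := nonZeroDivisors.ne_zero hb
  have hinj := IsFractionRing.injective (MvPolynomial (Fin n) K) F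
  have hne : ∀ {c : MvPolynomial (Fin n) K}, c ≠ 0 → algebraMap _ F c ≠ 0 := fun hc =>
    (map_ne_zero_iff _ hinj).2 hc
  have hiter := D.algebraMap_iterate_eq_mul D' hD' hf (div_mul_cancel₀ _ (hne hb0)).symm
  obtain ⟨k, hk0, hk⟩ := Function.exists_iterate_ne_zero_of_iterate_eq_zero hb0 (hD b)
  refine ⟨(⇑D)^[k] a, (⇑D)^[k] b, hk0, hinj ?_, hk, eq_div_of_mul_eq (hne hk0) (hiter k).symm⟩
  rw [← Function.iterate_succ_apply' D, hiter (k + 1), Function.iterate_succ_apply', hk, map_zero,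
    mul_zero]
end
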